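/- Let G be a finite simple graph and let v be a vertex of degree 1 in G. If the graph G − v obtained by deleting v has an odd 7-coloring, then G has an odd 7-coloring. -/

import Mathlib

/-- A coloring `c` is an odd coloring of `G`: it is proper, and every
non-isolated vertex has some color appearing an odd number of times in its
neighborhood. -/
def IsOddColoring {V α : Type*} (G : SimpleGraph V) (c : V → α) : Prop :=
  (∀ u v, G.Adj u v → c u ≠ c v) ∧
  ∀ v, (G.neighborSet v).Nonempty → ∃ a : α, Odd {w | G.Adj v w ∧ c w = a}.ncard

/-- `G` has an odd coloring using at most `k` colors. -/
def HasOddColoring {V : Type*} (G : SimpleGraph V) (k : ℕ) : Prop :=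
  ∃ c : V → Fin k, IsOddColoring G c

/-- Counts of a color around a vertex `x ≠ v` are the same in `G - v` and in `G`, unless `v` is a
neighbor of `x` with that color. -/
theorem ncard_adj_color_induce_compl_singleton {V α : Type*} (G : SimpleGraph V) {v : V}
    (c : V → α) (x : ({v}ᶜ : Set V)) {a : α} (h : G.Adj x v → c v ≠ a) :
    {w : ({v}ᶜ : Set V) | (G.induce ({v}ᶜ : Set V)).Adj x w ∧ c w = a}.ncard =
      {w | G.Adj x w ∧ c w = a}.ncard := by
  rw [← Set.ncard_image_of_injective _ Subtype.val_injective]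
  congr 1
  ext w
  constructor
  · rintro ⟨y, hy, rfl⟩
    exact hy
  · rintro ⟨hadj, hc⟩
    have hw : w ≠ v := by
      rintro rfl
      exact h hadj hc
    exact ⟨⟨w, hw⟩, ⟨hadj, hc⟩, rfl⟩

/-- A vertex with exactly one neighbor sees the color of that neighbor exactly once. -/
theorem exists_odd_ncard_of_neighborSet_eq_singleton {V α : Type*} {G : SimpleGraph V} {x y : V}
    (c : V → α) (h : G.neighborSet x = {y}) : ∃ a, Odd {w | G.Adj x w ∧ c w = a}.ncard := by
  have hadj (w : V) : G.Adj x w ↔ w = y := by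
    rw [← SimpleGraph.mem_neighborSet, h, Set.mem_singleton_iff]
  have hset : {w | G.Adj x w ∧ c w = c y} = {y} := by
    ext w
    simp +contextual [hadj]
  exact ⟨c y, by simp [hset]⟩

/-- If `v` has degree 1 in `G` and `G - v` has an odd 7-coloring, then so does `G`. -/
theorem hasOddColoring_of_delete_degree_one {V : Type*} [Fintype V]
    (G : SimpleGraph V) (v : V) (hdeg : (G.neighborSet v).ncard = 1)
    (h : HasOddColoring (G.induce ({v}ᶜ : Set V)) 7) :
    HasOddColoring G 7 := by
  obtain ⟨c₀, hproper, hodd⟩ := h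
  obtain ⟨u, hu⟩ := Set.ncard_eq_one.mp hdeg
  have hadj (w : V) : G.Adj v w ↔ w = u := by
    rw [← SimpleGraph.mem_neighborSet, hu, Set.mem_singleton_iff]
  have huv : u ≠ v := ((hadj u).mpr rfl).ne'
  let u' : ({v}ᶜ : Set V) := ⟨u, huv⟩
  obtain ⟨a, ha⟩ : ∃ a, ((G.induce ({v}ᶜ : Set V)).neighborSet u').Nonempty →
      Odd {w | (G.induce ({v}ᶜ : Set V)).Adj u' w ∧ c₀ w = a}.ncard := by
    by_cases hne : ((G.induce ({v}ᶜ : Set V)).neighborSet u').Nonempty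
    · exact (hodd u' hne).imp fun _ h _ => h
    · exact ⟨0, fun h => absurd h hne⟩
  obtain ⟨b, hbu, hba⟩ : ∃ b : Fin 7, b ≠ c₀ u' ∧ b ≠ a :=
    Fin.exists_ne_and_ne_of_two_lt _ _ (by norm_num)
  classical
  let c : V → Fin 7 := fun w => if hw : w = v then b else c₀ ⟨w, hw⟩
  have hcv : c v = b := dif_pos rfl
  have hc (w : ({v}ᶜ : Set V)) : c w = c₀ w := dif_neg w.2
  have hcu : c u = c₀ u' := hc u'
  refine ⟨c, fun x y hxy => ?_, fun x hx => ?_⟩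
  · by_cases hxv : x = v
    · subst hxv
      obtain rfl := (hadj y).mp hxy
      rwa [hcv, hcu]
    by_cases hyv : y = v
    · subst hyv
      obtain rfl := (hadj x).mp hxy.symm
      rw [hcv, hcu]
      exact hbu.symm
    rw [hc ⟨x, hxv⟩, hc ⟨y, hyv⟩]
    exact hproper ⟨x, hxv⟩ ⟨y, hyv⟩ hxy
  · by_cases hxv : x = v
    · exact exists_odd_ncard_of_neighborSet_eq_singleton c (hxv ▸ hu)
    simp only [← hc] at ha hodd
    by_cases hxu : x = u
    · subst hxu
      by_cases hne : ((G.induce ({v}ᶜ : Set V)).neighborSet u').Nonempty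
      · refine ⟨a, ?_⟩
        rw [← ncard_adj_color_induce_compl_singleton G c u' fun _ => hcv ▸ hba]
        exact ha hne
      · refine exists_odd_ncard_of_neighborSet_eq_singleton (y := v) c ?_
        refine hx.subset_singleton_iff.mp fun w hw => ?_
        by_contra hwv
        exact hne ⟨⟨w, hwv⟩, hw⟩
    · have hnadj : ¬ G.Adj x v := fun h => hxu ((hadj x).mp h.symm)
      obtain ⟨w, hw⟩ := hx
      have hwv : w ≠ v := by
        rintro rfl
        exact hnadj hw
      obtain ⟨d, hd⟩ := hodd ⟨x, hxv⟩ ⟨⟨w, hwv⟩, hw⟩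
      refine ⟨d, ?_⟩
      rwa [← ncard_adj_color_induce_compl_singleton G c ⟨x, hxv⟩ fun h => absurd h hnadj]
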